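/- Set L := 2·T_H(λ). There exists an injective map U from the set of sequences s : ℤ → {0,1} to the set of nonnegative C² functions on ℝ such that for every s: U(s) satisfies U(s)''(x) + λ·U(s)(x) − a·U(s)(x)^p = 0 for all x ∈ ℝ; U(s) ≡ 0 on ((i−1)L, iL) when s_i = 0 and U(s) > 0 on ((i−1)L, iL) when s_i = 1; and U is equivariant with respect to the shift, i.e. U(σs)(x) = U(s)(x + L) for all x ∈ ℝ, where σ is the shift map (σs)_i = s_{i+1}. -/

import Mathlib

/-- The extinction time `T_H(λ) = π/((1-p)·√λ)`. -/
noncomputable def TH (p lam : ℝ) : ℝ := Real.pi / ((1 - p) * Real.sqrt lam)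

open Filter Topology in
/-- Multiplying by a bounded factor preserves derivatives at points where the factor is locally
constant and at double zeros. -/
theorem hasDerivAt_bounded_mul {e F : ℝ → ℝ} {F' x : ℝ} (he : ∀ y, |e y| ≤ 1)
    (hF : HasDerivAt F F' x) (h : (F x = 0 ∧ F' = 0) ∨ ∀ᶠ y in 𝓝 x, e y = e x) :
    HasDerivAt (fun y => e y * F y) (e x * F') x := by
  rcases h with ⟨h0, h1⟩ | h
  · subst h1
    rw [hasDerivAt_iff_isLittleO] at hF ⊢
    simp only [h0, mul_zero, sub_zero, smul_zero] at hF ⊢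
    refine Asymptotics.IsBigO.trans_isLittleO (Asymptotics.IsBigO.of_bound 1 ?_) hF
    refine Eventually.of_forall fun y => ?_
    rw [norm_mul]
    exact mul_le_mul_of_nonneg_right (he y) (norm_nonneg _)
  · refine (hF.const_mul (e x)).congr_of_eventuallyEq ?_
    filter_upwards [h] with y hy
    rw [hy]

open Filter Topology in
theorem hasDerivAt_abs_rpow_mul_self {r : ℝ} (hr : 0 < r) (y : ℝ) :
    HasDerivAt (fun y : ℝ => |y| ^ r * y) ((r + 1) * |y| ^ r) y := by
  rcases eq_or_ne y 0 with rfl | hy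
  · rw [hasDerivAt_iff_isLittleO]
    simp only [abs_zero, Real.zero_rpow hr.ne', mul_zero, sub_zero, smul_zero]
    have h : (fun y : ℝ => |y| ^ r) =o[𝓝 0] fun _ => (1 : ℝ) := by
      rw [Asymptotics.isLittleO_one_iff]
      have hc : Continuous fun y : ℝ => |y| ^ r := continuous_abs.rpow_const fun _ => Or.inr hr.le
      simpa [Real.zero_rpow hr.ne'] using hc.tendsto 0
    simpa using h.mul_isBigO (Asymptotics.isBigO_refl (fun y : ℝ => y) (𝓝 0))
  · have h := ((hasDerivAt_abs hy).rpow_const (p := r) (Or.inl (abs_ne_zero.2 hy))).mul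
      (hasDerivAt_id y)
    refine h.congr_deriv ?_
    have h1 : |y| ^ r = |y| ^ (r - 1) * |y| := by
      rw [← Real.rpow_add_one (abs_ne_zero.2 hy), sub_add_cancel]
    have h2 : (SignType.sign y : ℝ) * y = |y| := sign_mul_self y
    simp only [id]
    rw [h1]
    linear_combination r * |y| ^ (r - 1) * h2

/-- The indicator of the union of the cells `[(i - 1) L, i L)` with `s i = 1`. -/
noncomputable def cellIndicator (L : ℝ) (s : ℤ → Fin 2) (x : ℝ) : ℝ :=
  if s (⌊x / L⌋ + 1) = 1 then 1 else 0

theorem abs_cellIndicator_le_one (L : ℝ) (s : ℤ → Fin 2) (x : ℝ) : |cellIndicator L s x| ≤ 1 := by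
  unfold cellIndicator
  split_ifs <;> simp

theorem cellIndicator_of_mem_Ioo {L : ℝ} (hL : 0 < L) (s : ℤ → Fin 2) {i : ℤ} {x : ℝ}
    (hx : x ∈ Set.Ioo (((i : ℝ) - 1) * L) (i * L)) :
    cellIndicator L s x = if s i = 1 then 1 else 0 := by
  have h : ⌊x / L⌋ = i - 1 := by
    rw [Int.floor_eq_iff]
    push_cast
    exact ⟨(le_div_iff₀ hL).2 hx.1.le, by rw [div_lt_iff₀ hL]; linarith [hx.2]⟩
  simp [cellIndicator, h]

theorem cellIndicator_shift {L : ℝ} (hL : 0 < L) (s : ℤ → Fin 2) (x : ℝ) :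
    cellIndicator L (fun i => s (i + 1)) x = cellIndicator L s (x + L) := by
  have h : (x + L) / L = x / L + 1 := by field_simp
  simp [cellIndicator, h]

theorem exists_mem_cell {L : ℝ} (hL : 0 < L) {x : ℝ} (hx : ∀ i : ℤ, x ≠ i * L) :
    ∃ i : ℤ, x ∈ Set.Ioo (((i : ℝ) - 1) * L) (i * L) := by
  refine ⟨⌊x / L⌋ + 1, ?_, ?_⟩
  · push_cast
    rw [add_sub_cancel_right]
    exact lt_of_le_of_ne ((le_div_iff₀ hL).1 (Int.floor_le _)) (hx _).symm
  · push_cast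
    exact (div_lt_iff₀ hL).1 (Int.lt_floor_add_one _)

open Filter Topology in
theorem cellIndicator_eventually_eq {L : ℝ} (hL : 0 < L) (s : ℤ → Fin 2) {x : ℝ}
    (hx : ∀ i : ℤ, x ≠ i * L) : ∀ᶠ y in 𝓝 x, cellIndicator L s y = cellIndicator L s x := by
  obtain ⟨i, hi⟩ := exists_mem_cell hL hx
  filter_upwards [isOpen_Ioo.mem_nhds hi] with y hy
  rw [cellIndicator_of_mem_Ioo hL s hy, cellIndicator_of_mem_Ioo hL s hi]

/-- Profile `A |sin (ω x)| ^ q` restricted to the cells selected by `s`, the cells having length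
`π / ω`. -/
noncomputable def bumps (A ω q : ℝ) (s : ℤ → Fin 2) (x : ℝ) : ℝ :=
  cellIndicator (Real.pi / ω) s x * (A * |Real.sin (ω * x)| ^ q)

theorem sin_mul_eq_zero_or {ω : ℝ} (hω : 0 < ω) (x : ℝ) :
    Real.sin (ω * x) = 0 ∨ ∀ i : ℤ, x ≠ i * (Real.pi / ω) := by
  refine or_iff_not_imp_left.2 fun h i hi => h ?_
  have h1 : ω * x = i * Real.pi := by rw [hi]; field_simp
  rw [h1, Real.sin_int_mul_pi]

theorem hasDerivAt_sin_const_mul (ω x : ℝ) :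
    HasDerivAt (fun x => Real.sin (ω * x)) (Real.cos (ω * x) * ω) x := by
  simpa using ((hasDerivAt_id x).const_mul ω).sin

theorem hasDerivAt_bumps (A : ℝ) {ω q : ℝ} (hω : 0 < ω) (hq : 2 < q) (s : ℤ → Fin 2) (x : ℝ) :
    HasDerivAt (bumps A ω q s) (cellIndicator (Real.pi / ω) s x *
      (A * q * ω * (|Real.sin (ω * x)| ^ (q - 2) * Real.sin (ω * x) * Real.cos (ω * x)))) x := by
  have hF : HasDerivAt (fun x => A * |Real.sin (ω * x)| ^ q) (A * q * ω *
      (|Real.sin (ω * x)| ^ (q - 2) * Real.sin (ω * x) * Real.cos (ω * x))) x := by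
    have h := (hasDerivAt_abs_rpow (Real.sin (ω * x)) (by linarith : 1 < q)).comp x
      (hasDerivAt_sin_const_mul ω x)
    exact (h.const_mul A).congr_deriv (by ring)
  refine hasDerivAt_bounded_mul (abs_cellIndicator_le_one _ s) hF ?_
  rcases sin_mul_eq_zero_or hω x with h | h
  · left
    simp [h, Real.zero_rpow (by linarith : q ≠ 0)]
  · exact Or.inr (cellIndicator_eventually_eq (by positivity) s h)

theorem hasDerivAt_deriv_bumps (A : ℝ) {ω q : ℝ} (hω : 0 < ω) (hq : 2 < q) (s : ℤ → Fin 2)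
    (x : ℝ) :
    HasDerivAt (deriv (bumps A ω q s)) (cellIndicator (Real.pi / ω) s x *
      (A * q * ω ^ 2 * ((q - 1) * |Real.sin (ω * x)| ^ (q - 2) - q * |Real.sin (ω * x)| ^ q))) x := by
  have hq2 : 0 < q - 2 := by linarith
  have hd : deriv (bumps A ω q s) = fun x => cellIndicator (Real.pi / ω) s x *
      (A * q * ω * (|Real.sin (ω * x)| ^ (q - 2) * Real.sin (ω * x) * Real.cos (ω * x))) :=
    funext fun x => (hasDerivAt_bumps A hω hq s x).deriv
  have hpow : |Real.sin (ω * x)| ^ q = |Real.sin (ω * x)| ^ (q - 2) * Real.sin (ω * x) ^ 2 := by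
    rw [← sq_abs, ← Real.rpow_natCast, ← Real.rpow_add_of_nonneg (abs_nonneg _) hq2.le (by simp)]
    norm_num
  have hcos : HasDerivAt (fun x => Real.cos (ω * x)) (-Real.sin (ω * x) * ω) x := by
    simpa using ((hasDerivAt_id x).const_mul ω).cos
  have hF : HasDerivAt (fun x => A * q * ω *
      (|Real.sin (ω * x)| ^ (q - 2) * Real.sin (ω * x) * Real.cos (ω * x)))
      (A * q * ω ^ 2 * ((q - 1) * |Real.sin (ω * x)| ^ (q - 2) - q * |Real.sin (ω * x)| ^ q)) x := by
    have h := ((hasDerivAt_abs_rpow_mul_self hq2 (Real.sin (ω * x))).comp x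
      (hasDerivAt_sin_const_mul ω x)).mul hcos
    refine (h.const_mul (A * q * ω)).congr_deriv ?_
    simp only [Function.comp_apply]
    rw [hpow]
    linear_combination A * q * ω ^ 2 * (q - 1) * |Real.sin (ω * x)| ^ (q - 2) *
      Real.sin_sq_add_cos_sq (ω * x)
  rw [hd]
  refine hasDerivAt_bounded_mul (abs_cellIndicator_le_one _ s) hF ?_
  rcases sin_mul_eq_zero_or hω x with h | h
  · left
    simp [h, Real.zero_rpow (by linarith : q ≠ 0), Real.zero_rpow hq2.ne']
  · exact Or.inr (cellIndicator_eventually_eq (by positivity) s h)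

theorem bumps_nonneg {A : ℝ} (hA : 0 ≤ A) (ω q : ℝ) (s : ℤ → Fin 2) (x : ℝ) :
    0 ≤ bumps A ω q s x := by
  have : 0 ≤ cellIndicator (Real.pi / ω) s x := by
    unfold cellIndicator
    split_ifs <;> norm_num
  unfold bumps
  positivity

theorem bumps_eq_zero {A ω q : ℝ} (hω : 0 < ω) {s : ℤ → Fin 2} {i : ℤ} (hi : s i = 0) {x : ℝ}
    (hx : x ∈ Set.Ioo (((i : ℝ) - 1) * (Real.pi / ω)) (i * (Real.pi / ω))) :
    bumps A ω q s x = 0 := by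
  simp [bumps, cellIndicator_of_mem_Ioo (by positivity) s hx, hi]

theorem bumps_pos {A ω q : ℝ} (hA : 0 < A) (hω : 0 < ω) {s : ℤ → Fin 2} {i : ℤ} (hi : s i = 1)
    {x : ℝ} (hx : x ∈ Set.Ioo (((i : ℝ) - 1) * (Real.pi / ω)) (i * (Real.pi / ω))) :
    0 < bumps A ω q s x := by
  have hsin : Real.sin (ω * x) ≠ 0 := by
    rw [Real.sin_ne_zero_iff]
    intro n hn
    have hxn : x = n * (Real.pi / ω) := by field_simp; linarith
    have hL : 0 < Real.pi / ω := by positivity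
    rw [hxn] at hx
    have h1 := lt_of_mul_lt_mul_right hx.1 hL.le
    have h2 := lt_of_mul_lt_mul_right hx.2 hL.le
    have h1' : i - 1 < n := by exact_mod_cast h1
    have h2' : n < i := by exact_mod_cast h2
    omega
  have : 0 < |Real.sin (ω * x)| := abs_pos.2 hsin
  simp only [bumps, cellIndicator_of_mem_Ioo (by positivity) s hx, hi, if_true]
  positivity

theorem bumps_injective {A ω q : ℝ} (hA : 0 < A) (hω : 0 < ω) :
    Function.Injective (bumps A ω q) := by
  intro s t hst
  funext i
  have hL : 0 < Real.pi / ω := by positivity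
  have hx : ((i : ℝ) - 1 / 2) * (Real.pi / ω) ∈
      Set.Ioo (((i : ℝ) - 1) * (Real.pi / ω)) (i * (Real.pi / ω)) := by
    constructor <;> nlinarith
  have hval := congrFun hst (((i : ℝ) - 1 / 2) * (Real.pi / ω))
  have hdich : ∀ k : Fin 2, k = 0 ∨ k = 1 := by decide
  rcases hdich (s i) with hs | hs <;> rcases hdich (t i) with ht | ht
  · rw [hs, ht]
  · exact absurd (hval.symm.trans (bumps_eq_zero hω hs hx)) (bumps_pos hA hω ht hx).ne'
  · exact absurd (hval.trans (bumps_eq_zero hω ht hx)) (bumps_pos hA hω hs hx).ne'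
  · rw [hs, ht]

theorem bumps_shift (A : ℝ) {ω : ℝ} (hω : 0 < ω) (q : ℝ) (s : ℤ → Fin 2) (x : ℝ) :
    bumps A ω q (fun i => s (i + 1)) x = bumps A ω q s (x + Real.pi / ω) := by
  have h : ω * (x + Real.pi / ω) = ω * x + Real.pi := by field_simp
  simp only [bumps, cellIndicator_shift (by positivity : 0 < Real.pi / ω), h, Real.sin_add_pi,
    abs_neg]

theorem deriv_deriv_bumps {a p A ω q : ℝ} (hp : 0 < p) (hA : 0 ≤ A) (hω : 0 < ω) (hq : 2 < q)
    (hqp : q * p = q - 2) (hAa : A * (q * (q - 1) * ω ^ 2) = a * A ^ p) (s : ℤ → Fin 2) (x : ℝ) :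
    deriv (deriv (bumps A ω q s)) x = a * bumps A ω q s x ^ p - (q * ω) ^ 2 * bumps A ω q s x := by
  rw [(hasDerivAt_deriv_bumps A hω hq s x).deriv]
  unfold bumps cellIndicator
  split_ifs
  · rw [one_mul, one_mul, Real.mul_rpow hA (by positivity), ← Real.rpow_mul (abs_nonneg _), hqp]
    linear_combination |Real.sin (ω * x)| ^ (q - 2) * hAa
  · simp [Real.zero_rpow hp.ne']

theorem contDiff_bumps {a p A ω q : ℝ} (hp : 0 < p) (hA : 0 ≤ A) (hω : 0 < ω) (hq : 2 < q)
    (hqp : q * p = q - 2) (hAa : A * (q * (q - 1) * ω ^ 2) = a * A ^ p) (s : ℤ → Fin 2) :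
    ContDiff ℝ 2 (bumps A ω q s) := by
  have hd : Differentiable ℝ (bumps A ω q s) := fun x =>
    (hasDerivAt_bumps A hω hq s x).differentiableAt
  have hd' : Differentiable ℝ (deriv (bumps A ω q s)) := fun x =>
    (hasDerivAt_deriv_bumps A hω hq s x).differentiableAt
  have hc : Continuous (deriv (deriv (bumps A ω q s))) := by
    rw [funext (deriv_deriv_bumps hp hA hω hq hqp hAa s)]
    exact (continuous_const.mul (hd.continuous.rpow_const fun _ => Or.inr hp.le)).sub
      (continuous_const.mul hd.continuous)
  rw [show (2 : WithTop ℕ∞) = 1 + 1 by norm_num, contDiff_succ_iff_deriv]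
  exact ⟨hd, by simp, contDiff_one_iff_deriv.2 ⟨hd', hc⟩⟩

theorem stmt15 (a p lam : ℝ) (ha : 0 < a) (hp0 : 0 < p) (hp1 : p < 1) (hlam : 0 < lam) :
    ∃ U : (ℤ → Fin 2) → (ℝ → ℝ),
      Function.Injective U ∧
      ∀ s : ℤ → Fin 2,
        ContDiff ℝ 2 (U s) ∧
        (∀ x : ℝ, 0 ≤ U s x) ∧
        (∀ x : ℝ, deriv (deriv (U s)) x + lam * U s x - a * U s x ^ p = 0) ∧
        (∀ i : ℤ, s i = 0 →
          ∀ x ∈ Set.Ioo (((i : ℝ) - 1) * (2 * TH p lam)) ((i : ℝ) * (2 * TH p lam)),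
            U s x = 0) ∧
        (∀ i : ℤ, s i = 1 →
          ∀ x ∈ Set.Ioo (((i : ℝ) - 1) * (2 * TH p lam)) ((i : ℝ) * (2 * TH p lam)),
            0 < U s x) ∧
        (∀ x : ℝ, U (fun i => s (i + 1)) x = U s (x + 2 * TH p lam)) := by
  have hp : 0 < 1 - p := by linarith
  have hsq : 0 < √lam := Real.sqrt_pos.2 hlam
  obtain ⟨q, hq_def⟩ : ∃ q, q = 2 / (1 - p) := ⟨_, rfl⟩
  obtain ⟨ω, hω_def⟩ : ∃ ω, ω = (1 - p) * √lam / 2 := ⟨_, rfl⟩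
  have hω : 0 < ω := by rw [hω_def]; positivity
  have hq : 2 < q := by
    rw [hq_def, lt_div_iff₀ hp]
    linarith
  have hq1 : 0 < q - 1 := by linarith
  have hqp : q * p = q - 2 := by
    rw [hq_def]
    field_simp
    ring
  have hqω : (q * ω) ^ 2 = lam := by
    have h : q * ω = √lam := by
      rw [hq_def, hω_def]
      field_simp
    rw [h, Real.sq_sqrt hlam.le]
  have hL : 2 * TH p lam = Real.pi / ω := by
    rw [TH, hω_def]
    field_simp
  have hK : 0 < q * (q - 1) * ω ^ 2 := by positivity
  obtain ⟨A, hA, hAa⟩ : ∃ A : ℝ, 0 < A ∧ A * (q * (q - 1) * ω ^ 2) = a * A ^ p := by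
    refine ⟨(a / (q * (q - 1) * ω ^ 2)) ^ (1 / (1 - p)), by positivity, ?_⟩
    have hB : 0 < a / (q * (q - 1) * ω ^ 2) := by positivity
    rw [← Real.rpow_mul hB.le,
      show 1 / (1 - p) = 1 + 1 / (1 - p) * p by field_simp; ring, Real.rpow_add hB, Real.rpow_one,
      show (1 + 1 / (1 - p) * p) * p = 1 / (1 - p) * p by field_simp; ring]
    field_simp
  rw [hL]
  refine ⟨bumps A ω q, bumps_injective hA hω, fun s =>
    ⟨contDiff_bumps hp0 hA.le hω hq hqp hAa s, bumps_nonneg hA.le ω q s, fun x => ?_,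
      fun i hi x hx => bumps_eq_zero hω hi hx, fun i hi x hx => bumps_pos hA hω hi hx,
      bumps_shift A hω q s⟩⟩
  rw [deriv_deriv_bumps hp0 hA.le hω hq hqp hAa, hqω]
  ring
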